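/- arXiv:2112.11882 — 4 statements merged into one kernel-verified Lean document; each statement's English description precedes it below -/
import Mathlib

section
/- For |q| < 1, Ramanujan's theta function satisfies φ(q) = ∑_{n=-∞}^{∞} q^{n²} = ∏_{k=0}^{∞} (1 + q^{2k+1})² (1 − q^{2k+2}). -/
/-- Ramanujan's theta function `φ(q) = ∑_{n ∈ ℤ} q^{n²}`. -/
noncomputable def phiC (q : ℂ) : ℂ := ∑' n : ℤ, q ^ (n.natAbs ^ 2)

open Filter Topology

/-- The finite `q`-Pochhammer product `(x; x)_m = ∏_{i < m} (1 - x^{i+1})`. -/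
noncomputable def eulerProd (x : ℂ) (m : ℕ) : ℂ := ∏ i ∈ Finset.range m, (1 - x ^ (i + 1))

/-- The reciprocal of `(x; x)_m`, extended by zero to negative `m`. -/
noncomputable def eulerProdInv (x : ℂ) (m : ℤ) : ℂ :=
  if 0 ≤ m then (eulerProd x m.toNat)⁻¹ else 0

lemma eulerProd_succ (x : ℂ) (m : ℕ) :
    eulerProd x (m + 1) = eulerProd x m * (1 - x ^ (m + 1)) :=
  Finset.prod_range_succ _ _

lemma one_sub_pow_succ_ne_zero {x : ℂ} (hx : ‖x‖ < 1) (m : ℕ) : 1 - x ^ (m + 1) ≠ 0 := by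
  intro h
  have h1 : ‖x ^ (m + 1)‖ < 1 := by
    rw [norm_pow]
    exact pow_lt_one₀ (norm_nonneg x) hx m.succ_ne_zero
  rw [← sub_eq_zero.mp h] at h1
  simp at h1

lemma eulerProd_ne_zero {x : ℂ} (hx : ‖x‖ < 1) (m : ℕ) : eulerProd x m ≠ 0 :=
  Finset.prod_ne_zero_iff.mpr fun i _ ↦ one_sub_pow_succ_ne_zero hx i

lemma eulerProdInv_of_neg (x : ℂ) {m : ℤ} (hm : m < 0) : eulerProdInv x m = 0 :=
  if_neg (not_le.mpr hm)

lemma eulerProdInv_natCast (x : ℂ) (m : ℕ) : eulerProdInv x m = (eulerProd x m)⁻¹ := by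
  simp [eulerProdInv]

lemma eulerProdInv_natCast_sub_one {x : ℂ} (hx : ‖x‖ < 1) (m : ℕ) :
    eulerProdInv x ((m : ℤ) - 1) = (1 - x ^ m) * eulerProdInv x m := by
  cases m with
  | zero => simp [eulerProdInv_of_neg]
  | succ m =>
    have h1 := one_sub_pow_succ_ne_zero hx m
    have h2 := eulerProd_ne_zero hx m
    rw [Nat.cast_succ, add_sub_cancel_right, ← Nat.cast_succ, eulerProdInv_natCast,
      eulerProdInv_natCast, Nat.succ_eq_add_one, eulerProd_succ]
    field_simp

lemma eulerProdInv_natCast_sub_two {x : ℂ} (hx : ‖x‖ < 1) (m : ℕ) :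
    eulerProdInv x ((m : ℤ) - 2) = (1 - x ^ (m - 1)) * (1 - x ^ m) * eulerProdInv x m := by
  cases m with
  | zero => simp [eulerProdInv_of_neg]
  | succ m =>
    have h := eulerProdInv_natCast_sub_one hx (m + 1)
    rw [Nat.cast_succ, add_sub_cancel_right] at h
    rw [show ((m + 1 : ℕ) : ℤ) - 2 = m - 1 by push_cast; ring, eulerProdInv_natCast_sub_one hx, h,
      Nat.add_sub_cancel, Nat.cast_succ, mul_assoc]

/-- The terms of the finite form of the Jacobi triple product:
a Gaussian binomial coefficient in base `q²` times `q^{j²}`. -/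
noncomputable def finiteThetaTerm (q : ℂ) (n : ℕ) (j : ℤ) : ℂ :=
  eulerProd (q ^ 2) (2 * n) * eulerProdInv (q ^ 2) (n - j) * eulerProdInv (q ^ 2) (n + j) *
    q ^ (j.natAbs ^ 2)

lemma norm_sq_lt_one {q : ℂ} (hq : ‖q‖ < 1) : ‖q ^ 2‖ < 1 := by
  rw [norm_pow]
  exact pow_lt_one₀ (norm_nonneg q) hq two_ne_zero

lemma finiteThetaTerm_succ {q : ℂ} (hq : ‖q‖ < 1) (n : ℕ) (j : ℤ) :
    finiteThetaTerm q (n + 1) j = (1 + q ^ (4 * n + 2)) * finiteThetaTerm q n j +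
      q ^ (2 * n + 1) * (finiteThetaTerm q n (j - 1) + finiteThetaTerm q n (j + 1)) := by
  have hx := norm_sq_lt_one hq
  unfold finiteThetaTerm
  by_cases hs : (n : ℤ) + 1 - j < 0
  · rw [eulerProdInv_of_neg (m := ((n + 1 : ℕ) : ℤ) - j) _ (by push_cast; omega),
      eulerProdInv_of_neg (m := (n : ℤ) - j) _ (by omega),
      eulerProdInv_of_neg (m := (n : ℤ) - (j - 1)) _ (by omega),
      eulerProdInv_of_neg (m := (n : ℤ) - (j + 1)) _ (by omega)]
    ring
  by_cases ht : (n : ℤ) + 1 + j < 0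
  · rw [eulerProdInv_of_neg (m := ((n + 1 : ℕ) : ℤ) + j) _ (by push_cast; omega),
      eulerProdInv_of_neg (m := (n : ℤ) + j) _ (by omega),
      eulerProdInv_of_neg (m := (n : ℤ) + (j - 1)) _ (by omega),
      eulerProdInv_of_neg (m := (n : ℤ) + (j + 1)) _ (by omega)]
    ring
  obtain ⟨s, hs⟩ := Int.eq_ofNat_of_zero_le (not_lt.mp hs)
  obtain ⟨t, ht⟩ := Int.eq_ofNat_of_zero_le (not_lt.mp ht)
  have hst : s + t = 2 * n + 2 := by omega
  have e1 : q ^ (2 * n + 1) * q ^ ((j - 1).natAbs ^ 2) = q ^ (j.natAbs ^ 2) * (q ^ 2) ^ s := by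
    rw [← pow_add, ← pow_mul, ← pow_add]
    congr 1
    zify
    rw [sq_abs, sq_abs, ← hs]
    ring
  have e2 : q ^ (2 * n + 1) * q ^ ((j + 1).natAbs ^ 2) = q ^ (j.natAbs ^ 2) * (q ^ 2) ^ t := by
    rw [← pow_add, ← pow_mul, ← pow_add]
    congr 1
    zify
    rw [sq_abs, sq_abs, ← ht]
    ring
  have hP : eulerProd (q ^ 2) (2 * (n + 1)) = eulerProd (q ^ 2) (2 * n) *
      (1 - (q ^ 2) ^ (2 * n + 1)) * (1 - (q ^ 2) ^ (2 * n + 2)) := by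
    rw [mul_add, mul_one, eulerProd_succ, eulerProd_succ]
  have hq4 : q ^ (4 * n + 2) = (q ^ 2) ^ (2 * n + 1) := by
    rw [← pow_mul]
    ring_nf
  rw [show ((n + 1 : ℕ) : ℤ) - j = s by push_cast; omega,
    show ((n + 1 : ℕ) : ℤ) + j = t by push_cast; omega,
    show (n : ℤ) - j = s - 1 by omega, show (n : ℤ) + j = t - 1 by omega,
    show (n : ℤ) - (j - 1) = s by omega, show (n : ℤ) + (j - 1) = t - 2 by omega,
    show (n : ℤ) - (j + 1) = s - 2 by omega, show (n : ℤ) + (j + 1) = t by omega,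
    eulerProdInv_natCast_sub_one hx, eulerProdInv_natCast_sub_one hx,
    eulerProdInv_natCast_sub_two hx, eulerProdInv_natCast_sub_two hx, hP, hq4]
  generalize q ^ 2 = x at *
  have hxs : ∀ a b : ℂ, q ^ (2 * n + 1) * (a * q ^ ((j - 1).natAbs ^ 2) +
      b * q ^ ((j + 1).natAbs ^ 2)) = q ^ (j.natAbs ^ 2) * (a * x ^ s + b * x ^ t) := by
    intro a b
    linear_combination a * e1 + b * e2
  rw [hxs]
  rcases s with _ | s
  · obtain rfl : t = 2 * n + 2 := by omega
    simp
    ring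
  rcases t with _ | t
  · obtain rfl : s = 2 * n + 1 := by omega
    simp
    ring
  have h2n : 2 * n = s + t := by omega
  rw [h2n, Nat.add_sub_cancel, Nat.add_sub_cancel]
  ring

lemma hasSum_finiteThetaTerm {q : ℂ} (hq : ‖q‖ < 1) (n : ℕ) :
    HasSum (finiteThetaTerm q n) (∏ k ∈ Finset.range n, (1 + q ^ (2 * k + 1)) ^ 2) := by
  induction n with
  | zero =>
    convert! hasSum_ite_eq (0 : ℤ) (1 : ℂ) using 2 with j
    unfold finiteThetaTerm
    rcases lt_trichotomy j 0 with h | rfl | h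
    · rw [eulerProdInv_of_neg (m := ((0 : ℕ) : ℤ) + j) _ (by simpa using h)]
      simp [h.ne]
    · simp [eulerProdInv, eulerProd]
    · rw [eulerProdInv_of_neg (m := ((0 : ℕ) : ℤ) - j) _ (by simpa using h)]
      simp [h.ne']
  | succ n ih =>
    have hl := (Equiv.subRight (1 : ℤ)).hasSum_iff.mpr ih
    have hr := (Equiv.addRight (1 : ℤ)).hasSum_iff.mpr ih
    convert! (ih.mul_left (1 + q ^ (4 * n + 2))).add ((hl.add hr).mul_left (q ^ (2 * n + 1)))
      using 1
    · funext j
      exact finiteThetaTerm_succ hq n j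
    · rw [Finset.prod_range_succ]
      ring

lemma multipliable_one_sub_pow_succ {x : ℂ} (hx : ‖x‖ < 1) :
    Multipliable fun i : ℕ ↦ 1 - x ^ (i + 1) := by
  simp_rw [sub_eq_add_neg]
  apply multipliable_one_add_of_summable
  simpa using (summable_nat_add_iff 1).mpr (summable_geometric_of_lt_one (norm_nonneg x) hx)

lemma tprod_one_sub_pow_succ_ne_zero {x : ℂ} (hx : ‖x‖ < 1) :
    ∏' i : ℕ, (1 - x ^ (i + 1)) ≠ 0 := by
  simp_rw [sub_eq_add_neg]
  apply tprod_one_add_ne_zero_of_summable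
  · intro i
    rw [← sub_eq_add_neg]
    exact one_sub_pow_succ_ne_zero hx i
  · simpa using (summable_nat_add_iff 1).mpr (summable_geometric_of_lt_one (norm_nonneg x) hx)

lemma tendsto_eulerProd {x : ℂ} (hx : ‖x‖ < 1) :
    Tendsto (eulerProd x) atTop (𝓝 (∏' i : ℕ, (1 - x ^ (i + 1)))) :=
  (multipliable_one_sub_pow_succ hx).tendsto_prod_tprod_nat

lemma tendsto_eulerProdInv {x : ℂ} (hx : ‖x‖ < 1) :
    Tendsto (eulerProdInv x) atTop (𝓝 (∏' i : ℕ, (1 - x ^ (i + 1)))⁻¹) := by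
  have htoNat : Tendsto Int.toNat atTop atTop := tendsto_atTop.mpr fun b ↦ by
    filter_upwards [eventually_ge_atTop (b : ℤ)] with m hm
    omega
  have h : Tendsto (fun m : ℤ ↦ (eulerProd x m.toNat)⁻¹) atTop
      (𝓝 (∏' i : ℕ, (1 - x ^ (i + 1)))⁻¹) :=
    ((tendsto_eulerProd hx).comp htoNat).inv₀ (tprod_one_sub_pow_succ_ne_zero hx)
  refine h.congr' ?_
  filter_upwards [eventually_ge_atTop 0] with m hm
  exact (if_pos hm).symm

lemma exists_norm_eulerProd_le {x : ℂ} (hx : ‖x‖ < 1) : ∃ C, ∀ m, ‖eulerProd x m‖ ≤ C := by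
  obtain ⟨C, hC⟩ := (tendsto_eulerProd hx).norm.bddAbove_range
  exact ⟨C, fun m ↦ hC ⟨m, rfl⟩⟩

lemma exists_norm_eulerProdInv_le {x : ℂ} (hx : ‖x‖ < 1) :
    ∃ C, ∀ m, ‖eulerProdInv x m‖ ≤ C := by
  obtain ⟨C, hC⟩ :=
    ((tendsto_eulerProd hx).inv₀ (tprod_one_sub_pow_succ_ne_zero hx)).norm.bddAbove_range
  refine ⟨C, fun m ↦ ?_⟩
  rcases lt_or_ge m 0 with hm | hm
  · rw [eulerProdInv_of_neg x hm, norm_zero]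
    exact (norm_nonneg _).trans (hC ⟨0, rfl⟩)
  · lift m to ℕ using hm
    rw [eulerProdInv_natCast]
    exact hC ⟨m, rfl⟩

lemma summable_norm_pow_natAbs_sq {q : ℂ} (hq : ‖q‖ < 1) :
    Summable fun j : ℤ ↦ ‖q‖ ^ (j.natAbs ^ 2) := by
  have h : Summable fun n : ℕ ↦ ‖q‖ ^ (n ^ 2) :=
    (summable_geometric_of_lt_one (norm_nonneg q) hq).of_nonneg_of_le (fun n ↦ by positivity)
      fun n ↦ pow_le_pow_of_le_one (norm_nonneg q) hq.le (Nat.le_self_pow two_ne_zero n)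
  exact .of_nat_of_neg (by simpa using h) (by simpa using h)

lemma tendsto_eulerProd_mul_tsum_finiteThetaTerm {q : ℂ} (hq : ‖q‖ < 1) :
    Tendsto (fun n ↦ ∑' j, eulerProd (q ^ 2) n * finiteThetaTerm q n j) atTop (𝓝 (phiC q)) := by
  have hx := norm_sq_lt_one hq
  obtain ⟨C, hC⟩ := exists_norm_eulerProd_le hx
  obtain ⟨D, hD⟩ := exists_norm_eulerProdInv_le hx
  have hC0 : 0 ≤ C := (norm_nonneg _).trans (hC 0)
  have hD0 : 0 ≤ D := (norm_nonneg _).trans (hD 0)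
  refine tendsto_tsum_of_dominated_convergence
    ((summable_norm_pow_natAbs_sq hq).mul_left (C * (C * D * D))) (fun j ↦ ?_)
    (.of_forall fun n j ↦ ?_)
  · have hL := tprod_one_sub_pow_succ_ne_zero hx
    have hP := tendsto_eulerProd hx
    have hP2 := hP.comp (tendsto_id.const_mul_atTop' (two_pos (α := ℕ)))
    have hcast := tendsto_natCast_atTop_atTop (R := ℤ)
    have hs := (tendsto_eulerProdInv hx).comp (tendsto_atTop_add_const_right _ (-j) hcast)
    have ht := (tendsto_eulerProdInv hx).comp (tendsto_atTop_add_const_right _ j hcast)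
    have := hP.mul (((hP2.mul hs).mul ht).mul_const (q ^ (j.natAbs ^ 2)))
    convert! this using 2
    field_simp
  · unfold finiteThetaTerm
    rw [norm_mul, norm_mul, norm_mul, norm_mul, norm_pow, ← mul_assoc]
    gcongr <;> first | exact hC _ | exact hD _

theorem phi_jacobi_triple_product (q : ℂ) (hq : ‖q‖ < 1) :
    phiC q = ∏' k : ℕ, (1 + q ^ (2 * k + 1)) ^ 2 * (1 - q ^ (2 * k + 2)) := by
  have hx := norm_sq_lt_one hq
  have hodd : Multipliable fun k : ℕ ↦ 1 + q ^ (2 * k + 1) := by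
    apply multipliable_one_add_of_summable
    simp_rw [norm_pow]
    exact (summable_geometric_of_lt_one (norm_nonneg q) hq).comp_injective
      (i := fun k : ℕ ↦ 2 * k + 1) fun a b h ↦ by simpa using h
  have heven : Multipliable fun k : ℕ ↦ 1 - q ^ (2 * k + 2) := by
    convert! multipliable_one_sub_pow_succ hx using 3 with k
    rw [← pow_mul, mul_add, mul_one]
  have hprod : Multipliable fun k : ℕ ↦ (1 + q ^ (2 * k + 1)) ^ 2 * (1 - q ^ (2 * k + 2)) := by
    convert! (hodd.mul hodd).mul heven using 3 with k
    exact pow_two _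
  refine tendsto_nhds_unique (tendsto_eulerProd_mul_tsum_finiteThetaTerm hq)
    (hprod.tendsto_prod_tprod_nat.congr fun n ↦ ?_)
  rw [tsum_mul_left, (hasSum_finiteThetaTerm hq n).tsum_eq, Finset.prod_mul_distrib, mul_comm]
  congr 1
  refine Finset.prod_congr rfl fun k _ ↦ ?_
  rw [← pow_mul, mul_add, mul_one]
end

section
/- φ(e^{−2π}) = (√(2+√2)/2) · π^{1/4} / Γ(3/4), where φ(q) = ∑_{n ∈ ℤ} q^{n²}. -/
open Real

/-- Ramanujan's theta function `φ(q) = ∑_{n ∈ ℤ} q^{n²}`. -/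
noncomputable def phi (q : ℝ) : ℝ := ∑' n : ℤ, q ^ (n.natAbs ^ 2)

open MeasureTheory Set Filter Topology

/-- The complete elliptic integral of the first kind in Gauss's symmetric form. -/
noncomputable def agmIntegral (a b : ℝ) : ℝ := ∫ x : ℝ, (√((x ^ 2 + a ^ 2) * (x ^ 2 + b ^ 2)))⁻¹


theorem integrable_inv_sq_add_sq {c : ℝ} (hc : 0 < c) :
    Integrable fun x : ℝ ↦ (x ^ 2 + c ^ 2)⁻¹ := by
  have h := (integrable_inv_one_add_sq.comp_mul_left' (inv_ne_zero hc.ne')).const_mul (c ^ 2)⁻¹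
  refine h.congr (ae_of_all _ fun x ↦ ?_)
  have : 0 < x ^ 2 + c ^ 2 := by positivity
  have : 0 < c ^ 2 + x ^ 2 := by positivity
  simp only
  rw [← mul_inv]
  congr 1
  field_simp
  ring

theorem integral_univ_inv_sq_add_sq {c : ℝ} (hc : 0 < c) : ∫ x : ℝ, (x ^ 2 + c ^ 2)⁻¹ = π / c := by
  have h := Measure.integral_comp_mul_left (fun x : ℝ ↦ (1 + x ^ 2)⁻¹) c⁻¹
  rw [integral_univ_inv_one_add_sq, inv_inv, abs_of_pos hc, smul_eq_mul] at h
  have h2 : (fun x : ℝ ↦ (x ^ 2 + c ^ 2)⁻¹) = fun x ↦ (c ^ 2)⁻¹ * (1 + (c⁻¹ * x) ^ 2)⁻¹ := by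
    funext x
    rw [← mul_inv]
    congr 1
    field_simp
    ring
  rw [h2, integral_const_mul, h]
  field_simp

theorem inv_sqrt_mul_le {m a b : ℝ} (hm : 0 < m) (ha : m ≤ a) (hb : m ≤ b) (x : ℝ) :
    (√((x ^ 2 + a ^ 2) * (x ^ 2 + b ^ 2)))⁻¹ ≤ (x ^ 2 + m ^ 2)⁻¹ := by
  have h0 : 0 < x ^ 2 + m ^ 2 := by positivity
  refine inv_anti₀ h0 (Real.le_sqrt_of_sq_le ?_)
  rw [sq (x ^ 2 + m ^ 2)]
  gcongr

theorem le_inv_sqrt_mul {M a b : ℝ} (ha0 : 0 < a) (hb0 : 0 < b) (ha : a ≤ M) (hb : b ≤ M) (x : ℝ) :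
    (x ^ 2 + M ^ 2)⁻¹ ≤ (√((x ^ 2 + a ^ 2) * (x ^ 2 + b ^ 2)))⁻¹ := by
  refine inv_anti₀ (by positivity) (Real.sqrt_le_iff.2 ⟨by positivity, ?_⟩)
  rw [sq (x ^ 2 + M ^ 2)]
  gcongr

theorem integrable_agmIntegrand {a b : ℝ} (ha : 0 < a) (hb : 0 < b) :
    Integrable fun x : ℝ ↦ (√((x ^ 2 + a ^ 2) * (x ^ 2 + b ^ 2)))⁻¹ := by
  have hm : 0 < min a b := lt_min ha hb
  refine (integrable_inv_sq_add_sq hm).mono' (by fun_prop) (ae_of_all _ fun x ↦ ?_)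
  rw [Real.norm_of_nonneg (by positivity)]
  exact inv_sqrt_mul_le hm (min_le_left _ _) (min_le_right _ _) x

theorem agmIntegral_le {m a b : ℝ} (hm : 0 < m) (ha : m ≤ a) (hb : m ≤ b) :
    agmIntegral a b ≤ π / m := by
  rw [← integral_univ_inv_sq_add_sq hm]
  exact integral_mono (integrable_agmIntegrand (hm.trans_le ha) (hm.trans_le hb))
    (integrable_inv_sq_add_sq hm) (inv_sqrt_mul_le hm ha hb)

theorem le_agmIntegral {M a b : ℝ} (ha0 : 0 < a) (hb0 : 0 < b) (ha : a ≤ M) (hb : b ≤ M) :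
    π / M ≤ agmIntegral a b := by
  rw [← integral_univ_inv_sq_add_sq (ha0.trans_le ha)]
  exact integral_mono (integrable_inv_sq_add_sq (ha0.trans_le ha))
    (integrable_agmIntegrand ha0 hb0) (le_inv_sqrt_mul ha0 hb0 ha hb)

theorem agmIntegral_mul {c : ℝ} (hc : 0 < c) (a b : ℝ) :
    agmIntegral (c * a) (c * b) = agmIntegral a b / c := by
  have h := Measure.integral_comp_mul_left
    (fun x : ℝ ↦ (√((x ^ 2 + (c * a) ^ 2) * (x ^ 2 + (c * b) ^ 2)))⁻¹) c
  have h2 : (fun x : ℝ ↦ (√(((c * x) ^ 2 + (c * a) ^ 2) * ((c * x) ^ 2 + (c * b) ^ 2)))⁻¹) =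
      fun x ↦ (c ^ 2)⁻¹ * (√((x ^ 2 + a ^ 2) * (x ^ 2 + b ^ 2)))⁻¹ := by
    funext x
    rw [← mul_inv, show ((c * x) ^ 2 + (c * a) ^ 2) * ((c * x) ^ 2 + (c * b) ^ 2) =
      (c ^ 2) ^ 2 * ((x ^ 2 + a ^ 2) * (x ^ 2 + b ^ 2)) by ring, Real.sqrt_mul (by positivity),
      Real.sqrt_sq (by positivity)]
  rw [h2, integral_const_mul, smul_eq_mul, abs_of_pos (inv_pos.2 hc)] at h
  unfold agmIntegral
  field_simp at h ⊢
  linarith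

theorem agmIntegral_eq_Ioi (a b : ℝ) :
    agmIntegral a b = 2 * ∫ x in Ioi (0 : ℝ), (√((x ^ 2 + a ^ 2) * (x ^ 2 + b ^ 2)))⁻¹ := by
  rw [← integral_comp_abs (f := fun x ↦ (√((x ^ 2 + a ^ 2) * (x ^ 2 + b ^ 2)))⁻¹)]
  simp only [sq_abs]
  rfl

/-- Gauss's invariance of the elliptic integral under the arithmetic-geometric mean step. -/
theorem agmIntegral_agm {a b g : ℝ} (ha : 0 < a) (hb : 0 < b) (hg : g ^ 2 = a * b) :
    agmIntegral ((a + b) / 2) g = agmIntegral a b := by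
  have hab : 0 < a * b := mul_pos ha hb
  set f : ℝ → ℝ := fun u ↦ (u - a * b / u) / 2 with hf
  have hmono : StrictMonoOn f (Ioi 0) := by
    intro x hx y hy hxy
    have : a * b / y < a * b / x := div_lt_div_of_pos_left hab hx hxy
    simp only [hf]
    linarith
  have himg : Set.image f (Ioi 0) = univ := by
    refine eq_univ_of_forall fun y ↦ ?_
    have hs : 0 ≤ y ^ 2 + a * b := by positivity
    have hlt : |y| < √(y ^ 2 + a * b) := by
      rw [← Real.sqrt_sq_eq_abs]
      exact Real.sqrt_lt_sqrt (sq_nonneg y) (by linarith)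
    have hpos : 0 < y + √(y ^ 2 + a * b) := by linarith [neg_abs_le y]
    refine ⟨y + √(y ^ 2 + a * b), hpos, ?_⟩
    simp only [hf]
    have := Real.sq_sqrt hs
    field_simp
    linarith
  have hder : ∀ x ∈ Ioi (0 : ℝ), HasDerivWithinAt f ((1 + a * b / x ^ 2) / 2) (Ioi 0) x := by
    intro x hx
    have hx0 : x ≠ 0 := ne_of_gt hx
    have h := ((hasDerivAt_id x).sub ((hasDerivAt_inv hx0).const_mul (a * b))).div_const 2
    refine (h.congr_deriv ?_).hasDerivWithinAt
    field_simp
    ring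
  have key := integral_image_eq_integral_abs_deriv_smul measurableSet_Ioi hder hmono.injOn
    (fun x ↦ (√((x ^ 2 + ((a + b) / 2) ^ 2) * (x ^ 2 + g ^ 2)))⁻¹)
  rw [himg, Measure.restrict_univ] at key
  rw [agmIntegral_eq_Ioi a b, ← integral_const_mul, agmIntegral, key]
  refine setIntegral_congr_fun measurableSet_Ioi fun u hu ↦ ?_
  have hu0 : 0 < u := hu
  have h1 : (f u ^ 2 + ((a + b) / 2) ^ 2) * (f u ^ 2 + g ^ 2) =
      ((u + a * b / u) / (4 * u)) ^ 2 * ((u ^ 2 + a ^ 2) * (u ^ 2 + b ^ 2)) := by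
    rw [hg]
    simp only [hf]
    field_simp
    ring
  have h2 : 0 < √((u ^ 2 + a ^ 2) * (u ^ 2 + b ^ 2)) := by positivity
  rw [smul_eq_mul, h1, Real.sqrt_mul (sq_nonneg _), Real.sqrt_sq (by positivity), abs_of_pos (by positivity)]
  have h3 : 0 < u ^ 2 + a * b := by positivity
  field_simp
  ring

theorem integral_beta {u v : ℝ} (hu : 0 < u) (hv : 0 < v) :
    ∫ x in Ioo (0 : ℝ) 1, x ^ (u - 1) * (1 - x) ^ (v - 1) = Gamma u * Gamma v / Gamma (u + v) := by
  have h := ProbabilityTheory.beta_eq_betaIntegralReal u v hu hv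
  rw [ProbabilityTheory.beta] at h
  rw [h, Complex.betaIntegral, intervalIntegral.integral_of_le zero_le_one,
    integral_Ioc_eq_integral_Ioo, ← Complex.ofReal_re (∫ x in Ioo (0 : ℝ) 1, _),
    ← integral_complex_ofReal]
  congr 1
  refine setIntegral_congr_fun measurableSet_Ioo fun x hx ↦ ?_
  rw [Complex.ofReal_mul, Complex.ofReal_cpow hx.1.le, Complex.ofReal_cpow (by linarith [hx.2])]
  push_cast
  rfl

theorem integral_beta_quarter_half :
    ∫ x in Ioo (0 : ℝ) 1, x ^ (1 / 4 - 1 : ℝ) * (1 - x) ^ (1 / 2 - 1 : ℝ) =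
      2 * agmIntegral (√2) 1 := by
  set f : ℝ → ℝ := fun x ↦ ((1 + x ^ 2) ^ 2)⁻¹ with hf
  have hanti : StrictAntiOn f (Ioi 0) := by
    intro x hx y hy hxy
    have hx0 : 0 < x := hx
    simp only [hf]
    gcongr
  have himg : Set.image f (Ioi 0) = Ioo 0 1 := by
    ext w
    constructor
    · rintro ⟨x, hx, rfl⟩
      have hx0 : 0 < x ^ 2 := pow_pos hx 2
      exact ⟨by positivity, inv_lt_one_of_one_lt₀ (by nlinarith)⟩
    · rintro ⟨h0, h1⟩
      have hs : 0 < √w := Real.sqrt_pos.2 h0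
      have hs1 : 1 < (√w)⁻¹ := (one_lt_inv₀ hs).2 (by
        rw [← Real.sqrt_one]; exact Real.sqrt_lt_sqrt h0.le h1)
      refine ⟨√((√w)⁻¹ - 1), Real.sqrt_pos.2 (by linarith), ?_⟩
      simp only [hf]
      rw [Real.sq_sqrt (by linarith), add_sub_cancel, inv_pow, inv_inv, Real.sq_sqrt h0.le]
  have hder : ∀ x ∈ Ioi (0 : ℝ),
      HasDerivWithinAt f (-(4 * x / (1 + x ^ 2) ^ 3)) (Ioi 0) x := by
    intro x hx
    have hx0 : (1 + x ^ 2) ^ 2 ≠ 0 := by positivity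
    have h := ((((hasDerivAt_pow 2 x).const_add 1).pow 2)).inv hx0
    refine (h.congr_deriv ?_).hasDerivWithinAt
    simp only [Nat.cast_ofNat, Pi.pow_apply]
    field_simp
    ring
  have key := integral_image_eq_integral_abs_deriv_smul measurableSet_Ioi hder hanti.injOn
    (fun x ↦ x ^ (1 / 4 - 1 : ℝ) * (1 - x) ^ (1 / 2 - 1 : ℝ))
  rw [himg] at key
  rw [key, agmIntegral_eq_Ioi, ← mul_assoc, ← integral_const_mul]
  refine setIntegral_congr_fun measurableSet_Ioi fun x hx ↦ ?_
  have hx0 : 0 < x := hx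
  have hy : 0 < 1 + x ^ 2 := by positivity
  have h1 : f x ^ (1 / 4 - 1 : ℝ) = (1 + x ^ 2) * √(1 + x ^ 2) := by
    simp only [hf]
    rw [Real.inv_rpow (by positivity), ← Real.rpow_neg (by positivity), ← Real.rpow_natCast,
      ← Real.rpow_mul hy.le, Real.sqrt_eq_rpow, ← Real.rpow_one_add' hy.le (by norm_num)]
    norm_num
  have h2 : (1 - f x) ^ (1 / 2 - 1 : ℝ) = (1 + x ^ 2) / (x * √(x ^ 2 + 2)) := by
    have : 1 - f x = (x / (1 + x ^ 2)) ^ 2 * (x ^ 2 + 2) := by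
      simp only [hf]
      field_simp
      ring
    rw [this, show (1 / 2 - 1 : ℝ) = -(1 / 2) by norm_num, Real.rpow_neg (by positivity),
      ← Real.sqrt_eq_rpow, Real.sqrt_mul (by positivity), Real.sqrt_sq (by positivity)]
    field_simp
  simp only [smul_eq_mul]
  rw [h1, h2, abs_neg, abs_of_pos (by positivity), Real.sq_sqrt (by norm_num), one_pow,
    Real.sqrt_mul (by positivity), add_comm (x ^ 2) 1]
  have h3 := Real.mul_self_sqrt hy.le
  have h4 : 0 < √(1 + x ^ 2) := Real.sqrt_pos.2 hy
  have h5 : 0 < √(x ^ 2 + 2) := by positivity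
  field_simp
  rw [sq, h3]
  ring

/-- The lemniscatic value of the elliptic integral. -/
theorem agmIntegral_sqrt_two_one :
    agmIntegral (√2) 1 = π * √(2 * π) / (2 * Gamma (3 / 4) ^ 2) := by
  have h := integral_beta_quarter_half
  rw [integral_beta (by norm_num) (by norm_num), Real.Gamma_one_half_eq,
    show (1 / 4 + 1 / 2 : ℝ) = 3 / 4 by norm_num] at h
  have h2 := Real.Gamma_mul_Gamma_one_sub (1 / 4)
  rw [show (1 - 1 / 4 : ℝ) = 3 / 4 by norm_num, show π * (1 / 4) = π / 4 by ring,
    Real.sin_pi_div_four] at h2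
  have hG : 0 < Gamma (3 / 4) := Real.Gamma_pos_of_pos (by norm_num)
  have hs := Real.mul_self_sqrt (show (0 : ℝ) ≤ 2 by norm_num)
  have h3 : Gamma (1 / 4) = π * √2 / Gamma (3 / 4) := by
    rw [eq_div_iff hG.ne', h2, div_div_eq_mul_div, div_eq_iff (by positivity)]
    linear_combination -π * hs
  rw [h3] at h
  rw [Real.sqrt_mul (by norm_num)]
  field_simp at h ⊢
  linarith

theorem agmIntegral_eq_pi_of_tendsto {a b : ℕ → ℝ} {I : ℝ} (ha : Tendsto a atTop (𝓝 1))
    (hb : Tendsto b atTop (𝓝 1)) (ha0 : ∀ n, 0 < a n) (hb0 : ∀ n, 0 < b n)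
    (hI : ∀ n, agmIntegral (a n) (b n) = I) : I = π := by
  apply le_antisymm
  · have h : Tendsto (fun n ↦ π / min (a n) (b n)) atTop (𝓝 π) := by
      have h1 := (tendsto_const_nhds (x := π)).div (ha.min hb) (by simp)
      rwa [min_self, div_one] at h1
    exact ge_of_tendsto' h fun n ↦ hI n ▸
      agmIntegral_le (lt_min (ha0 n) (hb0 n)) (min_le_left _ _) (min_le_right _ _)
  · have h : Tendsto (fun n ↦ π / max (a n) (b n)) atTop (𝓝 π) := by
      have h1 := (tendsto_const_nhds (x := π)).div (ha.max hb) (by simp)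
      rwa [max_self, div_one] at h1
    exact le_of_tendsto' h fun n ↦ hI n ▸
      le_agmIntegral (ha0 n) (hb0 n) (le_max_left _ _) (le_max_right _ _)


theorem norm_pow_natAbs_sq_le {q r : ℝ} (hr : r < 1) (hqr : |q| ≤ r) (n : ℤ) :
    ‖q ^ (n.natAbs ^ 2)‖ ≤ r ^ n.natAbs := by
  have h0 : 0 ≤ r := (abs_nonneg q).trans hqr
  rw [norm_pow, Real.norm_eq_abs]
  calc |q| ^ (n.natAbs ^ 2) ≤ r ^ (n.natAbs ^ 2) := by gcongr
    _ ≤ r ^ n.natAbs := pow_le_pow_of_le_one h0 hr.le (Nat.le_self_pow two_ne_zero _)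

theorem summable_pow_natAbs {r : ℝ} (h0 : 0 ≤ r) (h1 : r < 1) :
    Summable fun n : ℤ ↦ r ^ n.natAbs := by
  apply Summable.of_nat_of_neg <;> simpa using summable_geometric_of_lt_one h0 h1

theorem summable_norm_phi {q : ℝ} (hq : |q| < 1) :
    Summable fun n : ℤ ↦ ‖q ^ (n.natAbs ^ 2)‖ :=
  (summable_pow_natAbs (abs_nonneg q) hq).of_nonneg_of_le (fun _ ↦ norm_nonneg _)
    (norm_pow_natAbs_sq_le hq le_rfl)

theorem phi_zero : phi 0 = 1 := by
  rw [phi, tsum_eq_single 0 (fun n hn ↦ by simpa using hn)]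
  simp

theorem tendsto_phi_zero : Tendsto phi (𝓝 0) (𝓝 1) := by
  rw [← phi_zero]
  refine tendsto_tsum_of_dominated_convergence
    (summable_pow_natAbs (r := 1 / 2) (by norm_num) (by norm_num))
    (fun n ↦ (continuous_pow _).tendsto 0) ?_
  filter_upwards [Metric.closedBall_mem_nhds (0 : ℝ) (show (0 : ℝ) < 1 / 2 by norm_num)] with q hq n
  exact norm_pow_natAbs_sq_le (by norm_num) (by simpa using hq) n

theorem phi_pos {q : ℝ} (h0 : 0 < q) (h1 : q < 1) : 0 < phi q := by
  have hs : Summable fun n : ℤ ↦ q ^ (n.natAbs ^ 2) :=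
    (summable_norm_phi (by rwa [abs_of_pos h0])).of_norm
  exact hs.tsum_pos (fun n ↦ by positivity) 0 (by simp)

theorem phi_mul_phi {p q : ℝ} (hp : |p| < 1) (hq : |q| < 1) :
    phi p * phi q = ∑' z : ℤ × ℤ, p ^ (z.1.natAbs ^ 2) * q ^ (z.2.natAbs ^ 2) :=
  tsum_mul_tsum_of_summable_norm (summable_norm_phi hp) (summable_norm_phi hq)

theorem summable_phi_mul_phi {p q : ℝ} (hp : |p| < 1) (hq : |q| < 1) :
    Summable fun z : ℤ × ℤ ↦ p ^ (z.1.natAbs ^ 2) * q ^ (z.2.natAbs ^ 2) :=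
  summable_mul_of_summable_norm (f := fun n : ℤ ↦ p ^ (n.natAbs ^ 2))
    (g := fun n : ℤ ↦ q ^ (n.natAbs ^ 2)) (summable_norm_phi hp) (summable_norm_phi hq)

/-- A sum over `ℤ × ℤ` supported on the pairs of equal parity, in rotated coordinates. -/
theorem tsum_eq_tsum_add_sub {f : ℤ × ℤ → ℝ} (hf : ∀ m n, ¬ Even (m + n) → f (m, n) = 0) :
    ∑' z, f z = ∑' z : ℤ × ℤ, f (z.1 + z.2, z.1 - z.2) := by
  have hinj : Function.Injective fun z : ℤ × ℤ ↦ (z.1 + z.2, z.1 - z.2) := by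
    rintro ⟨a, b⟩ ⟨c, d⟩ h
    simp only [Prod.mk.injEq] at h ⊢
    omega
  refine (hinj.tsum_eq ?_).symm
  rintro ⟨m, n⟩ hmn
  by_contra h
  refine hmn (hf m n fun ⟨k, hk⟩ ↦ h ⟨(k, m - k), ?_⟩)
  simp only [Prod.mk.injEq]
  omega

theorem neg_pow_natAbs_sq (q : ℝ) (n : ℤ) :
    (-q) ^ (n.natAbs ^ 2) = (-1) ^ n.natAbs * q ^ (n.natAbs ^ 2) := by
  rw [neg_pow]
  congr 1
  rcases Nat.even_or_odd n.natAbs with h | h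
  · rw [h.neg_one_pow, (h.pow_of_ne_zero two_ne_zero).neg_one_pow]
  · rw [h.neg_one_pow, h.pow.neg_one_pow]

theorem neg_one_pow_natAbs_add (m n : ℤ) :
    (-1 : ℝ) ^ (m + n).natAbs = (-1) ^ m.natAbs * (-1) ^ n.natAbs := by
  rw [← pow_add, neg_one_pow_eq_pow_mod_two, neg_one_pow_eq_pow_mod_two (m.natAbs + n.natAbs)]
  congr 1
  omega

theorem neg_one_pow_natAbs_mul_eq_neg_one {m n : ℤ} (h : ¬ Even (m + n)) :
    (-1 : ℝ) ^ m.natAbs * (-1) ^ n.natAbs = -1 := by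
  rw [← neg_one_pow_natAbs_add]
  exact (Int.natAbs_odd.2 (Int.not_even_iff_odd.1 h)).neg_one_pow

theorem neg_one_pow_natAbs_sub (m n : ℤ) :
    (-1 : ℝ) ^ (m - n).natAbs = (-1) ^ (m + n).natAbs := by
  rw [neg_one_pow_eq_pow_mod_two, neg_one_pow_eq_pow_mod_two (m + n).natAbs]
  congr 1
  omega

theorem pow_natAbs_add_sq_mul_pow_natAbs_sub_sq (q : ℝ) (a b : ℤ) :
    q ^ ((a + b).natAbs ^ 2) * q ^ ((a - b).natAbs ^ 2) =
      (q ^ 2) ^ (a.natAbs ^ 2) * (q ^ 2) ^ (b.natAbs ^ 2) := by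
  rw [← pow_add, ← pow_add, ← pow_mul]
  congr 1
  zify
  simp only [sq_abs]
  ring

theorem neg_one_pow_mul_self (n : ℕ) : (-1 : ℝ) ^ n * (-1) ^ n = 1 := by
  rw [← mul_pow]
  simp

theorem phi_sq_add_phi_neg_sq {q : ℝ} (hq : |q| < 1) :
    phi q ^ 2 + phi (-q) ^ 2 = 2 * phi (q ^ 2) ^ 2 := by
  have hq' : |-q| < 1 := by rwa [abs_neg]
  have hq2 : |q ^ 2| < 1 := by rw [abs_pow]; exact pow_lt_one₀ (abs_nonneg q) hq two_ne_zero
  simp only [sq (phi _)]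
  rw [phi_mul_phi hq hq, phi_mul_phi hq' hq', phi_mul_phi hq2 hq2,
    ← (summable_phi_mul_phi hq hq).tsum_add (summable_phi_mul_phi hq' hq'),
    tsum_eq_tsum_add_sub, ← tsum_mul_left]
  · refine tsum_congr fun ⟨a, b⟩ ↦ ?_
    simp only [neg_pow_natAbs_sq q]
    rw [← pow_natAbs_add_sq_mul_pow_natAbs_sub_sq, neg_one_pow_natAbs_sub]
    linear_combination q ^ ((a + b).natAbs ^ 2) * q ^ ((a - b).natAbs ^ 2) *
      neg_one_pow_mul_self (a + b).natAbs
  · intro m n h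
    simp only [neg_pow_natAbs_sq q]
    linear_combination q ^ (m.natAbs ^ 2) * q ^ (n.natAbs ^ 2) *
      neg_one_pow_natAbs_mul_eq_neg_one h

theorem phi_mul_phi_neg {q : ℝ} (hq : |q| < 1) : phi q * phi (-q) = phi (-q ^ 2) ^ 2 := by
  have hq' : |-q| < 1 := by rwa [abs_neg]
  have hq2 : |-q ^ 2| < 1 := by
    rw [abs_neg, abs_pow]; exact pow_lt_one₀ (abs_nonneg q) hq two_ne_zero
  suffices h : phi q * phi (-q) + phi (-q) * phi q = 2 * (phi (-q ^ 2) * phi (-q ^ 2)) by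
    linarith
  rw [phi_mul_phi hq hq', phi_mul_phi hq' hq, phi_mul_phi hq2 hq2,
    ← (summable_phi_mul_phi hq hq').tsum_add (summable_phi_mul_phi hq' hq),
    tsum_eq_tsum_add_sub, ← tsum_mul_left]
  · refine tsum_congr fun ⟨a, b⟩ ↦ ?_
    simp only [neg_pow_natAbs_sq]
    rw [neg_one_pow_natAbs_sub, neg_one_pow_natAbs_add]
    linear_combination 2 * (-1) ^ a.natAbs * (-1) ^ b.natAbs *
      pow_natAbs_add_sq_mul_pow_natAbs_sub_sq q a b
  · intro m n h
    simp only [neg_pow_natAbs_sq]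
    have h1 := neg_one_pow_natAbs_mul_eq_neg_one h
    linear_combination q ^ (m.natAbs ^ 2) * q ^ (n.natAbs ^ 2) *
      ((-1) ^ n.natAbs * neg_one_pow_mul_self m.natAbs * (-1) + (-1) ^ m.natAbs * h1)

theorem tendsto_pow_two_pow {q : ℝ} (hq : |q| < 1) :
    Tendsto (fun k : ℕ ↦ q ^ 2 ^ k) atTop (𝓝 0) :=
  (tendsto_pow_atTop_nhds_zero_of_abs_lt_one hq).comp
    (tendsto_pow_atTop_atTop_of_one_lt one_lt_two)

theorem tendsto_phi_neg_pow_two_pow {q : ℝ} (hq : |q| < 1) :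
    Tendsto (fun k : ℕ ↦ phi (-q ^ 2 ^ k)) atTop (𝓝 1) :=
  tendsto_phi_zero.comp (by simpa using (tendsto_pow_two_pow hq).neg)

theorem phi_neg_ne_zero {q : ℝ} (hq : |q| < 1) : phi (-q) ≠ 0 := by
  intro h
  have hz : ∀ k : ℕ, phi (-q ^ 2 ^ k) = 0 := by
    intro k
    induction k with
    | zero => simpa using h
    | succ k ih =>
      have hk : |q ^ 2 ^ k| < 1 := by
        rw [abs_pow]; exact pow_lt_one₀ (abs_nonneg q) hq (by positivity)
      have h2 := phi_mul_phi_neg hk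
      rw [ih, mul_zero, ← pow_mul, ← pow_succ] at h2
      exact pow_eq_zero_iff two_ne_zero |>.1 h2.symm
  have := tendsto_phi_neg_pow_two_pow hq
  simp only [hz] at this
  exact zero_ne_one (tendsto_nhds_unique tendsto_const_nhds this)

theorem phi_exp_neg_pi_mul (t : ℝ) : phi (exp (-π * t)) = ∑' n : ℤ, exp (-π * t * (n : ℝ) ^ 2) := by
  refine tsum_congr fun n ↦ ?_
  rw [← Real.exp_nat_mul]
  congr 1
  push_cast
  rw [Nat.cast_natAbs, Int.cast_abs, sq_abs]
  ring

theorem phi_exp_neg_pi_div {t : ℝ} (ht : 0 < t) :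
    phi (exp (-π * (1 / t))) ^ 2 = t * phi (exp (-π * t)) ^ 2 := by
  have h := Real.tsum_exp_neg_mul_int_sq ht
  rw [← Real.sqrt_eq_rpow] at h
  rw [phi_exp_neg_pi_mul, phi_exp_neg_pi_mul, h, mul_pow, div_pow, Real.sq_sqrt ht.le]
  have h2 : ∀ n : ℤ, -π * (1 / t) * (n : ℝ) ^ 2 = -π / t * (n : ℝ) ^ 2 := fun n ↦ by ring
  simp only [h2]
  field_simp

theorem phi_ne_zero {q : ℝ} (hq : |q| < 1) : phi q ≠ 0 := by
  simpa using phi_neg_ne_zero (q := -q) (by rwa [abs_neg])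

theorem agmIntegral_phi_sq {q : ℝ} (hq : |q| < 1) :
    agmIntegral (phi q ^ 2) (phi (-q) ^ 2) = π := by
  have hqk : ∀ k : ℕ, |q ^ 2 ^ k| < 1 := fun k ↦ by
    rw [abs_pow]; exact pow_lt_one₀ (abs_nonneg q) hq (by positivity)
  have hpos : ∀ k : ℕ, 0 < phi (q ^ 2 ^ k) ^ 2 := fun k ↦ sq_pos_of_ne_zero (phi_ne_zero (hqk k))
  have hneg : ∀ k : ℕ, 0 < phi (-q ^ 2 ^ k) ^ 2 := fun k ↦
    sq_pos_of_ne_zero (phi_neg_ne_zero (hqk k))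
  refine agmIntegral_eq_pi_of_tendsto (a := fun k ↦ phi (q ^ 2 ^ k) ^ 2)
    (b := fun k ↦ phi (-q ^ 2 ^ k) ^ 2) ?_ ?_ hpos hneg fun k ↦ ?_
  · simpa using (tendsto_phi_zero.comp (tendsto_pow_two_pow hq)).pow 2
  · simpa using (tendsto_phi_neg_pow_two_pow hq).pow 2
  · induction k with
    | zero => simp
    | succ k ih =>
      have h1 := phi_sq_add_phi_neg_sq (hqk k)
      have h2 := phi_mul_phi_neg (hqk k)
      rw [← pow_mul, ← pow_succ] at h1 h2
      rw [← ih, ← agmIntegral_agm (hpos k) (hneg k) (g := phi (-q ^ 2 ^ (k + 1)) ^ 2)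
        (by rw [← h2, mul_pow]), h1, mul_div_cancel_left₀ _ two_ne_zero]

theorem exp_neg_pi_mul_lt_one {t : ℝ} (ht : 0 < t) : |exp (-π * t)| < 1 := by
  rw [abs_of_pos (exp_pos _), Real.exp_lt_one_iff]
  nlinarith [mul_pos Real.pi_pos ht]

theorem exp_neg_pi_mul_sq (t : ℝ) : exp (-π * t) ^ 2 = exp (-π * (2 * t)) := by
  rw [← Real.exp_nat_mul]
  congr 1
  push_cast
  ring

theorem phi_sq_exp_neg_pi_eq :
    phi (exp (-π * 1)) ^ 2 = √2 * phi (-exp (-π * 1)) ^ 2 ∧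
      4 * phi (exp (-π * 2)) ^ 2 = (2 + √2) * phi (exp (-π * 1)) ^ 2 := by
  have hq := exp_neg_pi_mul_lt_one (t := 1 / 2) (by norm_num)
  have h1 := phi_sq_add_phi_neg_sq hq
  have h2 := phi_mul_phi_neg hq
  have h3 := phi_sq_add_phi_neg_sq (exp_neg_pi_mul_lt_one one_pos)
  have h4 := phi_exp_neg_pi_div two_pos
  rw [exp_neg_pi_mul_sq, mul_one_div_cancel two_ne_zero] at h1 h2
  rw [exp_neg_pi_mul_sq, mul_one (2 : ℝ)] at h3
  set A := phi (exp (-π * 1)) ^ 2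
  set B := phi (-exp (-π * 1)) ^ 2
  have h5 : A ^ 2 = (√2 * B) ^ 2 := by
    rw [mul_pow, Real.sq_sqrt zero_le_two]
    have h6 : phi (exp (-π * (1 / 2))) ^ 2 = A + B := by linarith
    have h7 : phi (-exp (-π * (1 / 2))) ^ 2 = A - B := by linarith
    have h8 : B ^ 2 = (A + B) * (A - B) := by rw [← h6, ← h7, ← mul_pow, h2]
    linarith
  have h9 : A = √2 * B := (pow_left_inj₀ (sq_nonneg _) (by positivity) two_ne_zero).1 h5
  refine ⟨h9, ?_⟩
  linear_combination -2 * h3 - √2 * h9 - B * Real.sq_sqrt zero_le_two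

theorem phi_exp_neg_pi_sq : phi (exp (-π * 1)) ^ 2 = √π / Gamma (3 / 4) ^ 2 := by
  have hB := sq_pos_of_ne_zero (phi_neg_ne_zero (exp_neg_pi_mul_lt_one one_pos))
  have h := agmIntegral_phi_sq (exp_neg_pi_mul_lt_one one_pos)
  have h2 := agmIntegral_mul hB (√2) 1
  rw [mul_one (phi _ ^ 2), mul_comm _ √2, ← phi_sq_exp_neg_pi_eq.1, h, agmIntegral_sqrt_two_one,
    eq_div_iff hB.ne', Real.sqrt_mul zero_le_two] at h2
  rw [phi_sq_exp_neg_pi_eq.1]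
  have hG : 0 < Gamma (3 / 4) := Real.Gamma_pos_of_pos (by norm_num)
  have hs := Real.sq_sqrt (zero_le_two (α := ℝ))
  have hpi := Real.pi_pos
  field_simp at h2 ⊢
  linear_combination (√2 / 2) * h2 + √π / 2 * hs

theorem phi_exp_neg_two_pi :
    phi (Real.exp (-2 * π)) = (Real.sqrt (2 + Real.sqrt 2) / 2) * π ^ ((1:ℝ)/4) / Real.Gamma (3/4) := by
  have hG : 0 < Gamma (3 / 4) := Real.Gamma_pos_of_pos (by norm_num)
  have h := phi_sq_exp_neg_pi_eq.2
  rw [phi_exp_neg_pi_sq, show -π * 2 = -2 * π by ring] at h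
  have hpos : 0 < phi (exp (-2 * π)) :=
    phi_pos (exp_pos _) (Real.exp_lt_one_iff.2 (by linarith [Real.pi_pos]))
  refine (pow_left_inj₀ hpos.le (by positivity) two_ne_zero).1 ?_
  have h4 : (π ^ ((1 : ℝ) / 4)) ^ 2 = √π := by
    rw [← Real.rpow_mul_natCast Real.pi_pos.le, Real.sqrt_eq_rpow]
    norm_num
  rw [div_pow, mul_pow, div_pow, h4, Real.sq_sqrt (by positivity)]
  linear_combination h / 4
end

section
/- φ(e^{−5π}) = φ(e^{−π}) / √(5√5 − 10), where φ(q) = ∑_{n ∈ ℤ} q^{n²}. -/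
open Real

theorem summable_exp_neg_pi_mul_int_sq {a : ℝ} (ha : 0 < a) :
    Summable fun n : ℤ => Real.exp (-π * a * (n : ℝ) ^ 2) := by
  refine (summable_pow_mul_jacobiTheta₂_term_bound 0 ha 0).congr fun n => ?_
  rw [pow_zero, one_mul]
  congr 1
  ring

theorem phi_exp_neg_mul_pi (a : ℝ) :
    phi (Real.exp (-a * π)) = ∑' n : ℤ, Real.exp (-π * a * (n : ℝ) ^ 2) := by
  refine tsum_congr fun n => ?_
  rw [← Real.exp_nat_mul]
  congr 1
  have : ((n.natAbs ^ 2 : ℕ) : ℝ) = (n : ℝ) ^ 2 := by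
    rw [Nat.cast_pow, Nat.cast_natAbs, Int.cast_abs, sq_abs]
  rw [this]
  ring

theorem phi_exp_neg_mul_pi_pos {a : ℝ} (ha : 0 < a) : 0 < phi (Real.exp (-a * π)) := by
  rw [phi_exp_neg_mul_pi]
  exact (summable_exp_neg_pi_mul_int_sq ha).tsum_pos (fun _ => (Real.exp_pos _).le) 0
    (Real.exp_pos _)

theorem phi_exp_neg_pi_div_five :
    phi (Real.exp (-(1 / 5) * π)) = √5 * phi (Real.exp (-5 * π)) := by
  have h := Real.tsum_exp_neg_mul_int_sq (a := 5) (by norm_num)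
  rw [phi_exp_neg_mul_pi, phi_exp_neg_mul_pi, h, ← Real.sqrt_eq_rpow, ← mul_assoc,
    mul_one_div_cancel (by positivity), one_mul]
  exact tsum_congr fun n => by congr 1; ring

theorem cos_two_pi_div_five : Real.cos (2 * π / 5) = (√5 - 1) / 4 := by
  have h : 2 * π / 5 = 2 * (π / 5) := by ring
  rw [h, Real.cos_two_mul, Real.cos_pi_div_five]
  linear_combination (1 / 8) * Real.sq_sqrt (show (0 : ℝ) ≤ 5 by norm_num)

/-- The quadratic Gauss phases modulo `5` have only two distinct real parts. -/
theorem cos_two_pi_mul_int_sq_div_five (n : ℤ) :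
    Real.cos (2 * π / 5 * (n : ℝ) ^ 2) =
      Real.cos (2 * π / 5) + if (5 : ℤ) ∣ n then 1 - Real.cos (2 * π / 5) else 0 := by
  have key : ∃ m : ℤ, n ^ 2 = 5 * m ∧ 5 ∣ n ∨ n ^ 2 = 5 * m + 1 ∧ ¬ 5 ∣ n ∨
      n ^ 2 = 5 * m - 1 ∧ ¬ 5 ∣ n := by
    obtain ⟨k, hk⟩ : ∃ k, n = 5 * k ∨ n = 5 * k + 1 ∨ n = 5 * k + 2 ∨ n = 5 * k + 3 ∨ n = 5 * k + 4 :=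
      ⟨n / 5, by omega⟩
    rcases hk with h | h | h | h | h
    · exact ⟨5 * k ^ 2, .inl ⟨by rw [h]; ring, by omega⟩⟩
    · exact ⟨5 * k ^ 2 + 2 * k, .inr (.inl ⟨by rw [h]; ring, by omega⟩)⟩
    · exact ⟨5 * k ^ 2 + 4 * k + 1, .inr (.inr ⟨by rw [h]; ring, by omega⟩)⟩
    · exact ⟨5 * k ^ 2 + 6 * k + 2, .inr (.inr ⟨by rw [h]; ring, by omega⟩)⟩
    · exact ⟨5 * k ^ 2 + 8 * k + 3, .inr (.inl ⟨by rw [h]; ring, by omega⟩)⟩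
  obtain ⟨m, ⟨h, hd⟩ | ⟨h, hd⟩ | ⟨h, hd⟩⟩ := key <;>
    have hr := congrArg (Int.cast (R := ℝ)) h <;> push_cast at hr <;> rw [hr]
  · rw [if_pos hd, show 2 * π / 5 * (5 * (m : ℝ)) = m * (2 * π) by ring,
      Real.cos_int_mul_two_pi]
    ring
  · rw [if_neg hd, add_zero, show 2 * π / 5 * (5 * (m : ℝ) + 1) = 2 * π / 5 + m * (2 * π) by ring,
      Real.cos_add_int_mul_two_pi]
  · rw [if_neg hd, add_zero, show 2 * π / 5 * (5 * (m : ℝ) - 1) = m * (2 * π) - 2 * π / 5 by ring,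
      Real.cos_int_mul_two_pi_sub]

theorem hasSum_ite_five_dvd :
    HasSum (fun n : ℤ => if (5 : ℤ) ∣ n then Real.exp (-π * (1 / 5) * (n : ℝ) ^ 2) else 0)
      (phi (Real.exp (-5 * π))) := by
  rw [phi_exp_neg_mul_pi]
  have h := (summable_exp_neg_pi_mul_int_sq (a := 5) (by norm_num)).hasSum
  have hinj : Function.Injective fun n : ℤ => 5 * n := fun a b hab => by
    simpa using hab
  rw [← hinj.hasSum_iff]
  · convert h using 1
    ext n
    simp only [Function.comp_apply, dvd_mul_right, if_true]
    congr 1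
    push_cast
    ring
  · intro n hn
    rw [if_neg]
    rintro ⟨k, rfl⟩
    exact hn ⟨k, rfl⟩

/-- The real part of the theta value at `(2 + i) / 5`, expressed by values on the imaginary axis. -/
theorem hasSum_exp_mul_cos :
    HasSum (fun n : ℤ => Real.exp (-π * (1 / 5) * (n : ℝ) ^ 2) * Real.cos (2 * π / 5 * (n : ℝ) ^ 2))
      (phi (Real.exp (-(1 / 5) * π)) * Real.cos (2 * π / 5) +
        phi (Real.exp (-5 * π)) * (1 - Real.cos (2 * π / 5))) := by
  have h := (summable_exp_neg_pi_mul_int_sq (a := 1 / 5) (by norm_num)).hasSum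
  rw [← phi_exp_neg_mul_pi] at h
  have hadd := (h.mul_right (Real.cos (2 * π / 5))).add
    (hasSum_ite_five_dvd.mul_right (1 - Real.cos (2 * π / 5)))
  refine (congrArg (HasSum · _) (funext fun n => ?_)).mpr hadd
  rw [cos_two_pi_mul_int_sq_div_five]
  split_ifs <;> ring

/-- The modular transformation relating `(2 + i) / 5` to `i - 2`. -/
theorem exists_sq_eq_and_theta_eq :
    ∃ w : ℂ, w ^ 2 = 1 + 2 * Complex.I ∧
      phi (Real.exp (-(1 / 5) * π)) * Real.cos (2 * π / 5) +
        phi (Real.exp (-5 * π)) * (1 - Real.cos (2 * π / 5)) =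
      w.re * phi (Real.exp (-1 * π)) := by
  have ha : 0 < ((1 - 2 * Complex.I) / 5 : ℂ).re := by norm_num
  have ha0 : ((1 - 2 * Complex.I) / 5 : ℂ) ≠ 0 := fun h => by simp [h] at ha
  have hinv : 1 / ((1 - 2 * Complex.I) / 5 : ℂ) = 1 + 2 * Complex.I := by
    rw [div_eq_iff ha0]
    linear_combination (4 / 5) * Complex.I_sq
  have h := Complex.tsum_exp_neg_mul_int_sq ha
  refine ⟨1 / ((1 - 2 * Complex.I) / 5 : ℂ) ^ (1 / 2 : ℂ), ?_, ?_⟩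
  · rw [div_pow, one_pow, ← hinv, ← Complex.cpow_nat_mul]
    norm_num
  · have hterm (n : ℤ) : Complex.exp (-π / ((1 - 2 * Complex.I) / 5) * (n : ℂ) ^ 2) =
        ((Real.exp (-π * 1 * (n : ℝ) ^ 2) : ℝ) : ℂ) := by
      rw [div_eq_mul_one_div, hinv, Complex.ofReal_exp,
        Complex.exp_eq_exp_iff_exists_int]
      refine ⟨-n ^ 2, ?_⟩
      push_cast
      ring
    rw [tsum_congr hterm, ← Complex.ofReal_tsum, ← phi_exp_neg_mul_pi] at h
    have hre := congrArg Complex.re h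
    rw [Complex.re_mul_ofReal] at hre
    have him (n : ℤ) : (-π * ((1 - 2 * Complex.I) / 5) * (n : ℂ) ^ 2 : ℂ) =
        (-π * (1 / 5) * (n : ℝ) ^ 2 : ℝ) + (2 * π / 5 * (n : ℝ) ^ 2 : ℝ) * Complex.I := by
      push_cast
      ring
    rw [← hre, ← hasSum_exp_mul_cos.tsum_eq, Complex.re_tsum]
    · refine tsum_congr fun n => ?_
      rw [him, Complex.exp_re]
      simp only [Complex.add_re, Complex.add_im, Complex.ofReal_re, Complex.ofReal_im,
        Complex.re_ofReal_mul, Complex.im_ofReal_mul, Complex.I_re, Complex.I_im, mul_zero, mul_one,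
        add_zero, zero_add]
    · refine Summable.of_norm ((summable_exp_neg_pi_mul_int_sq (a := 1 / 5) (by norm_num)).congr
        fun n => ?_)
      rw [him, Complex.norm_exp]
      simp only [Complex.add_re, Complex.ofReal_re, Complex.re_ofReal_mul, Complex.I_re, mul_zero,
        add_zero]

theorem phi_exp_neg_five_pi :
    phi (Real.exp (-5 * π)) = phi (Real.exp (-π)) / Real.sqrt (5 * Real.sqrt 5 - 10) := by
  obtain ⟨w, hw, h⟩ := exists_sq_eq_and_theta_eq
  have hA := phi_exp_neg_mul_pi_pos (a := 5) (by norm_num)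
  have hT := phi_exp_neg_mul_pi_pos (a := 1) (by norm_num)
  rw [phi_exp_neg_pi_div_five, cos_two_pi_div_five] at h
  rw [neg_one_mul] at h hT
  set A := phi (Real.exp (-5 * π))
  set T := phi (Real.exp (-π))
  have h5 : √5 ^ 2 = 5 := Real.sq_sqrt (by norm_num)
  have h2 : 2 < √5 := by rw [Real.lt_sqrt] <;> norm_num
  have hre := congrArg Complex.re hw
  have him := congrArg Complex.im hw
  simp [pow_two] at hre him
  have hAw : A * (5 - √5) / 2 = w.re * T := by
    linear_combination h - A / 4 * h5
  have hu : w.re ^ 2 = (1 + √5) / 2 := by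
    have hq : (w.re ^ 2 - (1 + √5) / 2) * (w.re ^ 2 - (1 - √5) / 2) = 0 := by
      have : w.re * w.im = 1 := by linarith
      linear_combination w.re ^ 2 * hre + (w.re * w.im + 1) * this - h5 / 4
    rcases mul_eq_zero.mp hq with hq | hq
    · linarith
    · nlinarith [sq_nonneg w.re]
  rw [eq_div_iff (by apply ne_of_gt; apply Real.sqrt_pos.mpr; linarith),
    ← pow_left_inj₀ (by positivity) hT.le two_ne_zero, mul_pow, Real.sq_sqrt (by linarith)]
  have hsq : A ^ 2 * (5 - √5) ^ 2 = 2 * (1 + √5) * T ^ 2 := by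
    have := congrArg (· ^ 2) hAw
    simp only [mul_pow, div_pow, hu] at this
    linear_combination 4 * this
  have : (2 * (1 + √5)) * (A ^ 2 * (5 * √5 - 10)) = (2 * (1 + √5)) * T ^ 2 := by
    rw [← hsq]
    linear_combination 9 * A ^ 2 * h5
  exact mul_left_cancel₀ (by positivity) this
end

section
/- φ(e^{−9π}) / φ(e^{−π}) = (1 + (2(√3+1))^{1/3}) / 3, where φ(q) = ∑_{n ∈ ℤ} q^{n²}. -/
open Real

/-- The theta series `∑_{n ∈ ℤ} exp (-π t (3 n + c)²)` of the residue class of `c` modulo `3`. -/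
noncomputable def residueTheta (t : ℝ) (c : ℤ) : ℝ :=
  ∑' n : ℤ, Real.exp (-π * t * ((3 * n + c : ℤ) : ℝ) ^ 2)

/-- `phi` in terms of Gaussian sums. -/
theorem phi_exp_eq (t : ℝ) :
    phi (Real.exp (-π * t)) = ∑' n : ℤ, Real.exp (-π * t * (n : ℝ) ^ 2) := by
  unfold phi
  refine tsum_congr fun n => ?_
  rw [← Real.exp_nat_mul]
  congr 1
  push_cast
  rw [Nat.cast_natAbs, Int.cast_abs, sq_abs]
  ring

theorem summable_exp_neg_sq {t : ℝ} (ht : 0 < t) :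
    Summable fun n : ℤ => Real.exp (-π * t * (n : ℝ) ^ 2) := by
  have hlt : Real.exp (-π * t) < 1 := by
    rw [Real.exp_lt_one_iff]
    nlinarith [mul_pos Real.pi_pos ht]
  have hnat : Summable fun n : ℕ => Real.exp (-π * t * (n : ℝ) ^ 2) := by
    refine Summable.of_nonneg_of_le (fun n => (Real.exp_pos _).le) (fun n => ?_)
      (summable_geometric_of_lt_one (Real.exp_pos _).le hlt)
    rw [← Real.exp_nat_mul, Real.exp_le_exp]
    have h : (n : ℝ) ≤ (n : ℝ) ^ 2 := by exact_mod_cast Nat.le_self_pow two_ne_zero n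
    nlinarith [mul_le_mul_of_nonneg_left h (mul_pos Real.pi_pos ht).le]
  refine Summable.of_nat_of_neg ?_ ?_
  · simpa using hnat
  · simpa using hnat

theorem summable_residueTheta {t : ℝ} (ht : 0 < t) (c : ℤ) :
    Summable fun n : ℤ => Real.exp (-π * t * ((3 * n + c : ℤ) : ℝ) ^ 2) :=
  (summable_exp_neg_sq ht).comp_injective (i := fun n : ℤ => 3 * n + c)
    fun a b h => by simp only at h; omega

theorem residueTheta_add_three (t : ℝ) (c : ℤ) : residueTheta t (c + 3) = residueTheta t c := by
  unfold residueTheta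
  rw [← (Equiv.addRight (1 : ℤ)).tsum_eq
    fun n : ℤ => Real.exp (-π * t * ((3 * n + c : ℤ) : ℝ) ^ 2)]
  refine tsum_congr fun n => ?_
  simp only [Equiv.coe_addRight]
  congr 4
  ring

theorem residueTheta_neg (t : ℝ) (c : ℤ) : residueTheta t (-c) = residueTheta t c := by
  unfold residueTheta
  rw [← (Equiv.neg ℤ).tsum_eq
    fun n : ℤ => Real.exp (-π * t * ((3 * n + c : ℤ) : ℝ) ^ 2)]
  refine tsum_congr fun n => ?_
  simp only [Equiv.neg_apply]
  congr 1
  push_cast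
  ring

theorem residueTheta_two (t : ℝ) : residueTheta t 2 = residueTheta t 1 := by
  rw [← residueTheta_neg t 1, ← residueTheta_add_three t (-1)]
  norm_num

theorem residueTheta_zero (t : ℝ) : residueTheta t 0 = phi (Real.exp (-π * (9 * t))) := by
  rw [phi_exp_eq]
  unfold residueTheta
  refine tsum_congr fun n => ?_
  congr 1
  push_cast
  ring

/-- Division with remainder by `3`. -/
def intEquivFinThree : Fin 3 × ℤ ≃ ℤ where
  toFun p := 3 * p.2 + p.1
  invFun n := (⟨(n % 3).toNat, by omega⟩, n / 3)
  left_inv := by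
    rintro ⟨s, k⟩
    ext <;> simp <;> omega
  right_inv n := by simp; omega

theorem phi_eq_add_residueTheta {t : ℝ} (ht : 0 < t) :
    phi (Real.exp (-π * t)) = residueTheta t 0 + 2 * residueTheta t 1 := by
  have hs := intEquivFinThree.summable_iff.mpr (summable_exp_neg_sq ht)
  have key : phi (Real.exp (-π * t)) = ∑ s : Fin 3, residueTheta t (s : ℤ) := by
    rw [phi_exp_eq, ← intEquivFinThree.tsum_eq]
    exact hs.tsum_prod.trans (tsum_fintype _)
  rw [key, Fin.sum_univ_three]
  simp only [Fin.val_zero, Fin.val_one, Fin.val_two, Nat.cast_zero, Nat.cast_one, Nat.cast_ofNat]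
  rw [residueTheta_two]
  ring

theorem hasSum_mul_four {ι : Type*} {f g h k : ι → ℝ} (hf : Summable f) (hg : Summable g)
    (hh : Summable h) (hk : Summable k) (f0 : 0 ≤ f) (g0 : 0 ≤ g) (h0 : 0 ≤ h) (k0 : 0 ≤ k) :
    HasSum (fun p : ι × ι × ι × ι => f p.1 * (g p.2.1 * (h p.2.2.1 * k p.2.2.2)))
      ((∑' i, f i) * ((∑' i, g i) * ((∑' i, h i) * ∑' i, k i))) := by
  have s2 : Summable fun p : ι × ι => h p.1 * k p.2 := hh.mul_of_nonneg hk h0 k0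
  have n2 : 0 ≤ fun p : ι × ι => h p.1 * k p.2 := fun p => mul_nonneg (h0 _) (k0 _)
  have s3 : Summable fun p : ι × ι × ι => g p.1 * (h p.2.1 * k p.2.2) :=
    hg.mul_of_nonneg s2 g0 n2
  have n3 : 0 ≤ fun p : ι × ι × ι => g p.1 * (h p.2.1 * k p.2.2) :=
    fun p => mul_nonneg (g0 _) (n2 _)
  exact hf.hasSum.mul (hg.hasSum.mul (hh.hasSum.mul hk.hasSum s2) s3)
    (hf.mul_of_nonneg s3 f0 n3)

/-- The decomposition of `ℤ⁴` into the nine cosets of the image of an integral matrix `M` with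
`M Mᵀ = 3`. Scaled by `M`, it identifies `√3 ℤ⁴` with the lattice of integral vectors
whose reduction modulo `3` lies in the tetracode. -/
def tetracodeEquiv : (Fin 3 × Fin 3) × (ℤ × ℤ × ℤ × ℤ) ≃ ℤ × ℤ × ℤ × ℤ where
  toFun p := (p.1.1 + p.2.1 + p.2.2.1 + p.2.2.2.1, p.1.2 + p.2.1 - p.2.2.1 + p.2.2.2.2,
    p.2.1 - p.2.2.2.1 - p.2.2.2.2, p.2.2.1 - p.2.2.2.1 + p.2.2.2.2)
  invFun x :=
    let s := (x.1 - x.2.2.1 - x.2.2.2) % 3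
    let t := (x.2.1 - x.2.2.1 + x.2.2.2) % 3
    ((⟨s.toNat, by omega⟩, ⟨t.toNat, by omega⟩),
      ((x.1 - s + (x.2.1 - t) + x.2.2.1) / 3, (x.1 - s - (x.2.1 - t) + x.2.2.2) / 3,
        (x.1 - s - x.2.2.1 - x.2.2.2) / 3, (x.2.1 - t - x.2.2.1 + x.2.2.2) / 3))
  left_inv := by
    rintro ⟨⟨s, t⟩, a, b, c, d⟩
    ext <;> simp <;> omega
  right_inv := by
    rintro ⟨a, b, c, d⟩
    ext <;> simp <;> omega

theorem phi_pow_four_eq_sum {t : ℝ} (ht : 0 < t) :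
    phi (Real.exp (-π * (3 * t))) ^ 4 = ∑ p : Fin 3 × Fin 3,
      residueTheta t (p.1 + p.2) * (residueTheta t (p.1 - p.2) *
        (residueTheta t p.1 * residueTheta t p.2)) := by
  have hs := summable_exp_neg_sq (t := 3 * t) (by positivity)
  have hn : 0 ≤ fun n : ℤ => Real.exp (-π * (3 * t) * (n : ℝ) ^ 2) :=
    fun n => (Real.exp_pos _).le
  have h4 := hasSum_mul_four hs hs hs hs hn hn hn hn
  have e4 := tetracodeEquiv.hasSum_iff.mpr h4
  have hr (c : ℤ) : 0 ≤ fun n : ℤ => Real.exp (-π * t * ((3 * n + c : ℤ) : ℝ) ^ 2) :=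
    fun n => (Real.exp_pos _).le
  have hfib (p : Fin 3 × Fin 3) := hasSum_mul_four (summable_residueTheta ht (p.1 + p.2))
    (summable_residueTheta ht (p.1 - p.2)) (summable_residueTheta ht p.1)
    (summable_residueTheta ht p.2) (hr _) (hr _) (hr _) (hr _)
  have h := e4.prod_fiberwise fun p => (hfib p).congr_fun ?_
  · rw [phi_exp_eq]
    refine Eq.trans ?_ (h.unique (hasSum_fintype _))
    ring
  · rintro ⟨a, b, c, d⟩
    simp only [Function.comp_apply, tetracodeEquiv, Equiv.coe_fn_mk, ← Real.exp_add]
    congr 1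
    push_cast
    ring

/-- The cubic theta identity
`φ(q³)⁴ = φ(q) φ(q⁹) (φ(q)² - 3 φ(q) φ(q⁹) + 3 φ(q⁹)²)`. -/
theorem phi_pow_four {t : ℝ} (ht : 0 < t) :
    phi (Real.exp (-π * (3 * t))) ^ 4 =
      phi (Real.exp (-π * t)) * phi (Real.exp (-π * (9 * t))) *
        (phi (Real.exp (-π * t)) ^ 2 -
          3 * phi (Real.exp (-π * t)) * phi (Real.exp (-π * (9 * t))) +
          3 * phi (Real.exp (-π * (9 * t))) ^ 2) := by
  have h3 : residueTheta t 3 = residueTheta t 0 := residueTheta_add_three t 0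
  have h4 : residueTheta t 4 = residueTheta t 1 := residueTheta_add_three t 1
  have hm1 := residueTheta_neg t 1
  have hm2 := (residueTheta_neg t 2).trans (residueTheta_two t)
  rw [phi_pow_four_eq_sum ht, phi_eq_add_residueTheta ht, ← residueTheta_zero,
    Fintype.sum_prod_type]
  simp only [Fin.sum_univ_three, Fin.val_zero, Fin.val_one, Fin.val_two, Nat.cast_zero,
    Nat.cast_one, Nat.cast_ofNat]
  norm_num [residueTheta_two, h3, h4, hm1, hm2]
  ring

theorem phi_exp_pos {t : ℝ} (ht : 0 < t) : 0 < phi (Real.exp (-π * t)) := by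
  rw [phi_exp_eq]
  exact (summable_exp_neg_sq ht).tsum_pos (fun n => (Real.exp_pos _).le) 0 (Real.exp_pos _)

theorem phi_exp_third : phi (Real.exp (-π * (1 / 3))) = √3 * phi (Real.exp (-π * 3)) := by
  rw [phi_exp_eq, phi_exp_eq, Real.tsum_exp_neg_mul_int_sq (by norm_num), ← Real.sqrt_eq_rpow,
    show √(1 / 3 : ℝ) = 1 / √3 by rw [Real.sqrt_div zero_le_one, Real.sqrt_one], one_div_one_div]
  norm_num [div_eq_mul_inv]

theorem phi_exp_one_pow_four :
    phi (Real.exp (-π * 1)) ^ 4 = (6 * √3 - 9) * phi (Real.exp (-π * 3)) ^ 4 := by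
  have h := phi_pow_four (t := 1 / 3) (by norm_num)
  rw [phi_exp_third] at h
  norm_num at h ⊢
  rw [h]
  have hs : √3 ^ 2 = (3 : ℝ) := Real.sq_sqrt (by norm_num)
  linear_combination (phi (Real.exp (-(π * 3))) ^ 4 * (√3 - 3)) * hs

theorem phi_exp_neg_nine_pi :
    phi (Real.exp (-9 * π)) / phi (Real.exp (-π)) = (1 + (2 * (Real.sqrt 3 + 1)) ^ ((1:ℝ)/3)) / 3 := by
  have hA := phi_exp_pos (t := 1) one_pos
  have h1 := phi_exp_one_pow_four
  have h2 := phi_pow_four (t := 1) one_pos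
  rw [show -9 * π = -π * (9 * 1) by ring, show Real.exp (-π) = Real.exp (-π * 1) by rw [mul_one]]
  rw [mul_one 3] at h2
  set A := phi (Real.exp (-π * 1))
  set B := phi (Real.exp (-π * (9 * 1)))
  set C := phi (Real.exp (-π * 3))
  have hs : √3 ^ 2 = (3 : ℝ) := Real.sq_sqrt (by norm_num)
  have hcube : (3 * (B / A) - 1) ^ 3 = 2 * (√3 + 1) := by
    field_simp
    have hA4 : A * (3 * B - A) ^ 3 = A * (A ^ 3 * (2 * (√3 + 1))) := by
      linear_combination (-9) * h2 - (2 * √3 + 3) * h1 - 12 * C ^ 4 * hs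
    have := mul_left_cancel₀ hA.ne' hA4
    linear_combination this
  have hpos : 0 ≤ 3 * (B / A) - 1 := by
    by_contra! hneg
    have h := Odd.pow_neg (n := 3) (by decide) hneg
    rw [hcube] at h
    linarith [Real.sqrt_nonneg 3]
  have hroot : (2 * (√3 + 1)) ^ ((1 : ℝ) / 3) = 3 * (B / A) - 1 := by
    rw [← hcube, ← Real.rpow_natCast, ← Real.rpow_mul hpos]
    norm_num
  rw [hroot]
  ring
end
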